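/- arXiv:math/0102168 — 2 statements merged into one kernel-verified Lean document; each statement's English description precedes it below -/
import Mathlib

section
/- Let x ∈ S_n be a maximal singular point (MSP) for w ∈ S_n, and let s and s' be simple transpositions (s = t_{i,i+1}, s' = t_{j,j+1}). If l(sw) < l(w) then l(sx) < l(x), and if l(ws') < l(w) then l(xs') < l(x). -/
open scoped Classical

namespace BSW

/-- The number of inversions (the length) of a permutation of `Fin n`. -/
def invLen {n : ℕ} (w : Equiv.Perm (Fin n)) : ℕ :=
  (Finset.univ.filter (fun p : Fin n × Fin n => p.1 < p.2 ∧ w p.2 < w p.1)).card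

/-- The rank function `r_w(p,q) = #{i : 1 ≤ i ≤ p and w(i) ≥ q}`, where the
permutation of `Fin n` is regarded as a permutation of `{1,…,n}` (so position
`i : Fin n` corresponds to `i+1` and value `w i` to `(w i)+1`). -/
def rank {n : ℕ} (w : Equiv.Perm (Fin n)) (p q : ℤ) : ℕ :=
  (Finset.univ.filter (fun i : Fin n =>
    ((i : ℕ) : ℤ) + 1 ≤ p ∧ q ≤ ((w i : ℕ) : ℤ) + 1)).card

/-- The difference function `d_{x,w}(p,q) = r_w(p,q) − r_x(p,q)`. -/
def dxw {n : ℕ} (x w : Equiv.Perm (Fin n)) (p q : ℤ) : ℤ :=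
  (rank w p q : ℤ) - (rank x p q : ℤ)

/-- The Bruhat order: `x ≤ w` iff `d_{x,w}` is everywhere non-negative. -/
def bruhatLE {n : ℕ} (x w : Equiv.Perm (Fin n)) : Prop :=
  ∀ p q : ℤ, 0 ≤ dxw x w p q

/-- The set of transpositions in `S_n`. -/
def transpositions (n : ℕ) : Set (Equiv.Perm (Fin n)) :=
  {t | ∃ a b : Fin n, a ≠ b ∧ t = Equiv.swap a b}

/-- `R(x,w) = {t ∈ T : l(xt) > l(x) and xt ≤ w}`. -/
def R {n : ℕ} (x w : Equiv.Perm (Fin n)) : Set (Equiv.Perm (Fin n)) :=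
  {t | t ∈ transpositions n ∧ invLen x < invLen (x * t) ∧ bruhatLE (x * t) w}

/-- `x` is a maximal singular point (MSP) for `w`. -/
def MSP {n : ℕ} (x w : Equiv.Perm (Fin n)) : Prop :=
  bruhatLE x w ∧ ((invLen w : ℤ) - (invLen x : ℤ) < ((R x w).ncard : ℤ)) ∧
    ∀ t ∈ R x w, ((R (x * t) w).ncard : ℤ) = (invLen w : ℤ) - (invLen (x * t) : ℤ)

/-- `Δ(x,w) = {i : t_{{i,j}} ∈ R(x,w) for some j}`. -/
def Delta {n : ℕ} (x w : Equiv.Perm (Fin n)) : Set (Fin n) :=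
  {i | ∃ j : Fin n, Equiv.swap i j ∈ R x w}

/-- `Δ(x,w)` as a finset. -/
noncomputable def DeltaFinset {n : ℕ} (x w : Equiv.Perm (Fin n)) : Finset (Fin n) :=
  (Set.toFinite (Delta x w)).toFinset

/-- `σ ∈ S_k` is the flattening of `x` along the increasing enumeration `d_1 < … < d_k`
of a set `D` of positions with `#D = k`: the unique permutation of `{1,…,k}` with
`σ(a) < σ(b)` iff `x(d_a) < x(d_b)`. -/
def IsFlatteningOn {n k : ℕ} (x : Equiv.Perm (Fin n)) (D : Finset (Fin n))
    (hD : D.card = k) (σ : Equiv.Perm (Fin k)) : Prop :=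
  ∀ a b : Fin k, σ a < σ b ↔ x ((D.orderIsoOfFin hD a : Fin n)) < x ((D.orderIsoOfFin hD b : Fin n))

/-- Values (0-indexed) of the permutation `x_{k,m} = [k,…,1, k+m,…,k+1]`. -/
def xkmVal (k m i : ℕ) : ℕ :=
  if i < k then k - 1 - i else 2 * k + m - 1 - i

/-- Values (0-indexed) of the permutation `w_{k,m} = [k+m, k,…,2, k+m−1,…,k+1, 1]`. -/
def wkmVal (k m i : ℕ) : ℕ :=
  if i = 0 then k + m - 1
  else if i < k then k - i
  else if i < k + m - 1 then 2 * k + m - 2 - i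
  else 0

/-- Values (0-indexed) of the permutation `x_{k,l,m} = [k,…,1, k+l,…,k+1, k+l+m,…,k+l+1]`. -/
def xklmVal (k l m i : ℕ) : ℕ :=
  if i < k then k - 1 - i
  else if i < k + l then 2 * k + l - 1 - i
  else 2 * (k + l) + m - 1 - i

/-- Values (0-indexed) of the permutation
`w_{k,l,m} = [k+l, k,…,2, k+l+m, k+l−1,…,k+2, 1, k+l+m−1,…,k+l+1, k+1]`. -/
def wklmVal (k l m i : ℕ) : ℕ :=
  if i = 0 then k + l - 1
  else if i < k then k - i
  else if i = k then k + l + m - 1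
  else if i < k + l - 1 then 2 * k + l - 1 - i
  else if i = k + l - 1 then 0
  else if i < k + l + m - 1 then 2 * (k + l) + m - 2 - i
  else k


/-- Composing with a transposition that puts two increasing values in decreasing order
increases the length. -/
lemma invLen_lt_invLen_mul_swap {n : ℕ} (x : Equiv.Perm (Fin n)) {a b : Fin n}
    (hab : a < b) (h : x a < x b) : invLen x < invLen (x * Equiv.swap a b) := by
  set t := Equiv.swap a b with ht
  have htt : ∀ i, t (t i) = i := fun i => Equiv.swap_apply_self a b i
  have hta : t a = b := Equiv.swap_apply_left a b
  have htb : t b = a := Equiv.swap_apply_right a b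
  have hto : ∀ i, i ≠ a → i ≠ b → t i = i := fun i => Equiv.swap_apply_of_ne_of_ne
  let f : Fin n × Fin n → Fin n × Fin n := fun p => if t p.1 < t p.2 then (t p.1, t p.2) else p
  have hmem : (a, b) ∈ Finset.univ.filter
      (fun p : Fin n × Fin n => p.1 < p.2 ∧ (x * t) p.2 < (x * t) p.1) := by
    rw [Finset.mem_filter]
    simp only [Finset.mem_univ, true_and, Equiv.Perm.mul_apply, hta, htb]
    exact ⟨hab, h⟩
  unfold invLen
  refine lt_of_le_of_lt ?_ (Finset.card_erase_lt_of_mem hmem)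
  refine Finset.card_le_card_of_injOn f ?_ ?_
  · rintro ⟨i, j⟩ hij
    simp only [Finset.coe_filter, Finset.mem_univ, true_and, Set.mem_ofPred_eq] at hij
    simp only [Finset.coe_erase, Finset.coe_filter, Finset.mem_univ, true_and, Set.mem_sdiff,
      Set.mem_ofPred_eq, Set.mem_singleton_iff, f]
    simp only [Equiv.Perm.mul_apply]
    split_ifs with hlt
    · simp only [htt]
      refine ⟨⟨hlt, hij.2⟩, fun he => ?_⟩
      have h1 : i = b := by rw [← htt i, (Prod.mk.inj he).1, hta]
      have h2 : j = a := by rw [← htt j, (Prod.mk.inj he).2, htb]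
      subst h1 h2
      exact absurd hij.1 hab.not_gt
    · have hne : (i, j) ≠ (a, b) := by
        intro he
        obtain ⟨rfl, rfl⟩ := Prod.mk.inj he
        exact absurd hij.2 h.not_gt
      refine ⟨⟨hij.1, ?_⟩, hne⟩
      by_cases hia : i = a <;> by_cases hib : i = b <;> by_cases hja : j = a <;>
        by_cases hjb : j = b <;> grind
  · rintro ⟨i, j⟩ hij ⟨k, l⟩ hkl he
    simp only [Finset.coe_filter, Finset.mem_univ, true_and, Set.mem_ofPred_eq] at hij hkl
    simp only [f] at he
    grind

lemma invLen_mul_swap_lt_iff {n : ℕ} (x : Equiv.Perm (Fin n)) {a b : Fin n} (hab : a < b) :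
    invLen (x * Equiv.swap a b) < invLen x ↔ x b < x a := by
  constructor
  · intro h
    by_contra hc
    have hne : x a ≠ x b := fun he => hab.ne (x.injective he)
    exact absurd (invLen_lt_invLen_mul_swap x hab (lt_of_le_of_ne (not_lt.mp hc) hne)) h.not_gt
  · intro h
    simpa [mul_assoc] using
      invLen_lt_invLen_mul_swap (x * Equiv.swap a b) hab (by simpa using h)

lemma invLen_mul_swap_ne {n : ℕ} (x : Equiv.Perm (Fin n)) {a b : Fin n} (hab : a ≠ b) :
    invLen (x * Equiv.swap a b) ≠ invLen x := by
  wlog hlt : a < b generalizing a b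
  · rw [Equiv.swap_comm]
    exact this hab.symm (lt_of_le_of_ne (not_lt.mp hlt) hab.symm)
  rcases lt_or_gt_of_ne (fun he => hab (x.injective he) : x a ≠ x b) with h | h
  · exact (invLen_lt_invLen_mul_swap x hlt h).ne'
  · exact ((invLen_mul_swap_lt_iff x hlt).mpr h).ne

lemma bruhatLE_iff {n : ℕ} {x w : Equiv.Perm (Fin n)} :
    bruhatLE x w ↔ ∀ p q : ℤ, rank x p q ≤ rank w p q := by
  simp [bruhatLE, dxw]

lemma bruhatLE.trans {n : ℕ} {x y w : Equiv.Perm (Fin n)} (hxy : bruhatLE x y)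
    (hyw : bruhatLE y w) : bruhatLE x w :=
  bruhatLE_iff.mpr fun p q =>
    (bruhatLE_iff.mp hxy p q).trans (bruhatLE_iff.mp hyw p q)

lemma bruhatLE_mul_swap {n : ℕ} (x : Equiv.Perm (Fin n)) {a b : Fin n} (hab : a < b)
    (h : x b < x a) : bruhatLE (x * Equiv.swap a b) x := by
  rw [bruhatLE_iff]
  intro p q
  set t := Equiv.swap a b with ht
  have htt : ∀ i, t (t i) = i := fun i => Equiv.swap_apply_self a b i
  have hta : t a = b := Equiv.swap_apply_left a b
  have htb : t b = a := Equiv.swap_apply_right a b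
  have hto : ∀ i, i ≠ a → i ≠ b → t i = i := fun i => Equiv.swap_apply_of_ne_of_ne
  have hab' : (a : ℕ) < b := hab
  have h' : (x b : ℕ) < x a := h
  unfold rank
  refine Finset.card_le_card_of_injOn
    (fun i => if ((t i : ℕ) : ℤ) + 1 ≤ p then t i else i) ?_ ?_
  · intro i hi
    simp only [Finset.coe_filter, Finset.mem_univ, true_and, Set.mem_ofPred_eq] at hi ⊢
    simp only [Equiv.Perm.mul_apply] at hi
    split_ifs with hp
    · exact ⟨hp, hi.2⟩
    · refine ⟨hi.1, ?_⟩
      by_cases hia : i = a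
      · subst hia
        rw [hta] at hi
        omega
      · by_cases hib : i = b
        · subst hib
          rw [htb] at hp
          omega
        · rw [hto i hia hib] at hi
          exact hi.2
  · intro i hi j hj he
    simp only [Finset.coe_filter, Finset.mem_univ, true_and, Set.mem_ofPred_eq] at hi hj
    dsimp only at he
    grind

/-- The transpositions `t` with `x * t ≤ w` in the Bruhat order, without a length condition. -/
def reflectionsBelow {n : ℕ} (x w : Equiv.Perm (Fin n)) : Set (Equiv.Perm (Fin n)) :=
  {t | t ∈ transpositions n ∧ bruhatLE (x * t) w}

/-- The number of transpositions that decrease the length of `x` is the length of `x`. -/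
lemma ncard_length_decreasing {n : ℕ} (x : Equiv.Perm (Fin n)) :
    {t | t ∈ transpositions n ∧ invLen (x * t) < invLen x}.ncard = invLen x := by
  have himg : {t | t ∈ transpositions n ∧ invLen (x * t) < invLen x} =
      (fun p : Fin n × Fin n => Equiv.swap p.1 p.2) ''
        (Finset.univ.filter (fun p : Fin n × Fin n => p.1 < p.2 ∧ x p.2 < x p.1) :
          Finset (Fin n × Fin n)) := by
    ext t
    simp only [Set.mem_ofPred_eq, Set.mem_image, Finset.coe_filter, Finset.mem_univ, true_and]
    constructor
    · rintro ⟨⟨a, b, hab, rfl⟩, hlt⟩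
      rcases lt_or_gt_of_ne hab with h | h
      · exact ⟨(a, b), ⟨h, (invLen_mul_swap_lt_iff x h).mp hlt⟩, rfl⟩
      · rw [Equiv.swap_comm] at hlt
        exact ⟨(b, a), ⟨h, (invLen_mul_swap_lt_iff x h).mp hlt⟩, Equiv.swap_comm _ _⟩
    · rintro ⟨⟨a, b⟩, ⟨h, hx⟩, rfl⟩
      exact ⟨⟨a, b, h.ne, rfl⟩, (invLen_mul_swap_lt_iff x h).mpr hx⟩
  rw [himg, Set.InjOn.ncard_image, Set.ncard_coe_finset]
  · rfl
  · rintro ⟨a, b⟩ hab ⟨c, d⟩ hcd he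
    simp only [Finset.coe_filter, Finset.mem_univ, true_and, Set.mem_ofPred_eq] at hab hcd
    dsimp only at he
    have h1 : Equiv.swap a b a = Equiv.swap c d a := by rw [he]
    have h2 : Equiv.swap a b b = Equiv.swap c d b := by rw [he]
    simp only [Equiv.swap_apply_left, Equiv.swap_apply_right] at h1 h2
    simp only [Equiv.swap_apply_def] at h1 h2
    grind

lemma ncard_reflectionsBelow {n : ℕ} {x w : Equiv.Perm (Fin n)} (hxw : bruhatLE x w) :
    (reflectionsBelow x w).ncard = (R x w).ncard + invLen x := by
  have hunion : reflectionsBelow x w =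
      R x w ∪ {t | t ∈ transpositions n ∧ invLen (x * t) < invLen x} := by
    ext t
    simp only [reflectionsBelow, R, Set.mem_union, Set.mem_ofPred_eq]
    constructor
    · rintro ⟨⟨a, b, hab, rfl⟩, hle⟩
      rcases lt_or_gt_of_ne (invLen_mul_swap_ne x hab) with h | h
      · exact Or.inr ⟨⟨a, b, hab, rfl⟩, h⟩
      · exact Or.inl ⟨⟨a, b, hab, rfl⟩, h, hle⟩
    · rintro (⟨ht, -, hle⟩ | ⟨⟨a, b, hab, rfl⟩, hlt⟩)
      · exact ⟨ht, hle⟩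
      · refine ⟨⟨a, b, hab, rfl⟩, bruhatLE.trans ?_ hxw⟩
        rcases lt_or_gt_of_ne hab with h | h
        · exact bruhatLE_mul_swap x h ((invLen_mul_swap_lt_iff x h).mp hlt)
        · rw [Equiv.swap_comm] at hlt ⊢
          exact bruhatLE_mul_swap x h ((invLen_mul_swap_lt_iff x h).mp hlt)
  rw [hunion, Set.ncard_union_eq ?_ (Set.toFinite _) (Set.toFinite _), ncard_length_decreasing]
  rw [Set.disjoint_left]
  rintro t ⟨-, h, -⟩ ⟨-, h'⟩
  exact absurd h h'.not_gt

lemma MSP.ncard_reflectionsBelow_ne {n : ℕ} {x w t : Equiv.Perm (Fin n)} (h : MSP x w)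
    (ht : t ∈ R x w) : (reflectionsBelow (x * t) w).ncard ≠ (reflectionsBelow x w).ncard := by
  obtain ⟨hle, hlt, heq⟩ := h
  have := heq t ht
  rw [ncard_reflectionsBelow hle, ncard_reflectionsBelow ht.2.2]
  omega

lemma rank_mono_left {n : ℕ} (w : Equiv.Perm (Fin n)) {p p' : ℤ} (h : p ≤ p') (q : ℤ) :
    rank w p q ≤ rank w p' q :=
  Finset.card_le_card (Finset.monotone_filter_right _ fun _ _ hi => ⟨hi.1.trans h, hi.2⟩)

lemma rank_anti_right {n : ℕ} (w : Equiv.Perm (Fin n)) (p : ℤ) {q q' : ℤ} (h : q ≤ q') :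
    rank w p q' ≤ rank w p q :=
  Finset.card_le_card (Finset.monotone_filter_right _ fun _ _ hi => ⟨hi.1, h.trans hi.2⟩)

lemma rank_position_succ {n : ℕ} (w : Equiv.Perm (Fin n)) (a : Fin n) (q : ℤ) :
    rank w ((a : ℕ) + 1 : ℤ) q =
      rank w ((a : ℕ) : ℤ) q + if q ≤ ((w a : ℕ) : ℤ) + 1 then 1 else 0 := by
  unfold rank
  split_ifs with h
  · rw [← Finset.card_insert_of_notMem (a := a) (by simp)]
    congr 1
    ext i
    simp only [Finset.mem_filter, Finset.mem_univ, true_and, Finset.mem_insert]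
    constructor
    · intro hi
      by_cases hia : i = a
      · exact Or.inl hia
      · have : (i : ℕ) ≠ a := fun e => hia (Fin.ext e)
        exact Or.inr ⟨by omega, hi.2⟩
    · rintro (rfl | hi)
      · exact ⟨le_rfl, h⟩
      · exact ⟨by omega, hi.2⟩
  · rw [add_zero]
    congr 1
    ext i
    simp only [Finset.mem_filter, Finset.mem_univ, true_and]
    constructor
    · intro hi
      have : (i : ℕ) ≠ a := fun e => h (Fin.ext e ▸ hi.2)
      exact ⟨by omega, hi.2⟩
    · exact fun hi => ⟨by omega, hi.2⟩

lemma rank_value_succ {n : ℕ} (w : Equiv.Perm (Fin n)) (p : ℤ) (i : Fin n) :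
    rank w p ((w i : ℕ) + 1 : ℤ) =
      rank w p ((w i : ℕ) + 2 : ℤ) + if ((i : ℕ) : ℤ) + 1 ≤ p then 1 else 0 := by
  unfold rank
  split_ifs with h
  · rw [← Finset.card_insert_of_notMem (a := i) (by simp)]
    congr 1
    ext j
    simp only [Finset.mem_filter, Finset.mem_univ, true_and, Finset.mem_insert]
    constructor
    · intro hj
      by_cases hji : j = i
      · exact Or.inl hji
      · have : (w j : ℕ) ≠ w i := fun e => hji (w.injective (Fin.ext e))
        exact Or.inr ⟨hj.1, by omega⟩
    · rintro (rfl | hj)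
      · exact ⟨h, le_rfl⟩
      · exact ⟨hj.1, by omega⟩
  · rw [add_zero]
    congr 1
    ext j
    simp only [Finset.mem_filter, Finset.mem_univ, true_and]
    constructor
    · intro hj
      have : (w j : ℕ) ≠ w i := fun e => h (w.injective (Fin.ext e) ▸ hj.1)
      exact ⟨hj.1, by omega⟩
    · exact fun hj => ⟨hj.1, by omega⟩

lemma rank_mul_swap_of_ne {n : ℕ} (y : Equiv.Perm (Fin n)) {a b : Fin n}
    (hab : (b : ℕ) = (a : ℕ) + 1) {p : ℤ} (hp : p ≠ (a : ℕ) + 1) (q : ℤ) :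
    rank (y * Equiv.swap a b) p q = rank y p q := by
  unfold rank
  refine Finset.card_equiv (Equiv.swap a b) fun i => ?_
  simp only [Finset.mem_filter, Finset.mem_univ, true_and]
  simp only [Equiv.Perm.mul_apply]
  refine and_congr_left fun _ => ?_
  simp only [Equiv.swap_apply_def]
  split_ifs with h h <;> (try subst h) <;> omega

lemma rank_swap_mul_of_ne {n : ℕ} (y : Equiv.Perm (Fin n)) {a b : Fin n}
    (hab : (b : ℕ) = (a : ℕ) + 1) (p : ℤ) {q : ℤ} (hq : q ≠ (b : ℕ) + 1) :
    rank (Equiv.swap a b * y) p q = rank y p q := by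
  unfold rank
  congr 1
  ext i
  simp only [Finset.mem_filter, Finset.mem_univ, true_and]
  simp only [Equiv.Perm.mul_apply]
  refine and_congr_right fun _ => ?_
  simp only [Equiv.swap_apply_def]
  split_ifs with h h <;> (try rw [h]) <;> omega

lemma apply_inv_apply {n : ℕ} (w : Equiv.Perm (Fin n)) (i : Fin n) : w (w⁻¹ i) = i :=
  w.apply_symm_apply i

/-- The lifting property of the Bruhat order for right descents. -/
lemma bruhatLE.mul_swap {n : ℕ} {y w : Equiv.Perm (Fin n)} {a b : Fin n}
    (hab : (b : ℕ) = (a : ℕ) + 1) (hw : w b < w a) (h : bruhatLE y w) :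
    bruhatLE (y * Equiv.swap a b) w := by
  rw [bruhatLE_iff] at h ⊢
  intro p q
  have hw' : (w b : ℕ) < w a := hw
  by_cases hp : p = (a : ℕ) + 1
  · subst hp
    have hwa := rank_position_succ w a q
    have hwb := rank_position_succ w b q
    have hya := rank_position_succ (y * Equiv.swap a b) a q
    have hmono := rank_mono_left (y * Equiv.swap a b)
      (show ((a : ℕ) + 1 : ℤ) ≤ (a : ℕ) + 1 + 1 by omega) q
    have hlow := rank_mul_swap_of_ne y hab (p := ((a : ℕ) : ℤ)) (by omega) q
    have hhigh := rank_mul_swap_of_ne y hab (p := (a : ℕ) + 1 + 1) (by omega) q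
    have h1 := h ((a : ℕ) : ℤ) q
    have h2 := h ((a : ℕ) + 1 + 1) q
    rw [hab, Nat.cast_succ] at hwb
    split_ifs at hwa hwb hya <;> omega
  · rw [rank_mul_swap_of_ne y hab hp]
    exact h p q

/-- The lifting property of the Bruhat order for left descents. -/
lemma bruhatLE.swap_mul {n : ℕ} {y w : Equiv.Perm (Fin n)} {a b : Fin n}
    (hab : (b : ℕ) = (a : ℕ) + 1) (hw : w⁻¹ b < w⁻¹ a) (h : bruhatLE y w) :
    bruhatLE (Equiv.swap a b * y) w := by
  rw [bruhatLE_iff] at h ⊢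
  intro p q
  have hw' : (w⁻¹ b : ℕ) < (w⁻¹ a : ℕ) := hw
  by_cases hq : q = (b : ℕ) + 1
  · subst hq
    have hwa := rank_value_succ w p (w⁻¹ a)
    have hwb := rank_value_succ w p (w⁻¹ b)
    have hyb := rank_value_succ (Equiv.swap a b * y) p ((Equiv.swap a b * y)⁻¹ b)
    have hanti := rank_anti_right (Equiv.swap a b * y) p
      (show ((a : ℕ) + 1 : ℤ) ≤ (b : ℕ) + 1 by omega)
    have hlow := rank_swap_mul_of_ne y hab p (q := (a : ℕ) + 1) (by omega)
    have hhigh := rank_swap_mul_of_ne y hab p (q := (b : ℕ) + 2) (by omega)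
    have h1 := h p ((a : ℕ) + 1)
    have h2 := h p ((b : ℕ) + 2)
    rw [apply_inv_apply] at hwa hwb hyb
    have hcast : ((a : ℕ) + 2 : ℤ) = (b : ℕ) + 1 := by omega
    rw [hcast] at hwa
    split_ifs at hwa hwb hyb <;> omega
  · rw [rank_swap_mul_of_ne y hab p hq]
    exact h p q

/-- If `x` is an MSP for `w` and `s, s'` are simple transpositions, then
`l(sw) < l(w)` implies `l(sx) < l(x)`, and `l(ws') < l(w)` implies `l(xs') < l(x)`. -/
theorem msp_descent {n : ℕ} (x w : Equiv.Perm (Fin n)) (hmsp : MSP x w)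
    (a b a' b' : Fin n) (hab : (b : ℕ) = (a : ℕ) + 1) (hab' : (b' : ℕ) = (a' : ℕ) + 1) :
    (invLen (Equiv.swap a b * w) < invLen w → invLen (Equiv.swap a b * x) < invLen x) ∧
      (invLen (w * Equiv.swap a' b') < invLen w → invLen (x * Equiv.swap a' b') < invLen x) := by
  obtain ⟨hle, -⟩ := id hmsp
  have hlt : a < b := Fin.lt_def.mpr (by omega)
  have hlt' : a' < b' := Fin.lt_def.mpr (by omega)
  constructor
  · intro hw
    have hdesc : w⁻¹ b < w⁻¹ a := by
      rw [Equiv.swap_mul_eq_mul_swap] at hw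
      by_contra hc
      have hne : w⁻¹ a ≠ w⁻¹ b := fun he => hlt.ne (w⁻¹.injective he)
      rw [invLen_mul_swap_lt_iff w (lt_of_le_of_ne (not_lt.mp hc) hne)] at hw
      simp only [apply_inv_apply] at hw
      exact absurd hw hlt.not_gt
    by_contra hx
    have hne : x⁻¹ a ≠ x⁻¹ b := fun he => hlt.ne (x⁻¹.injective he)
    have hmem : Equiv.swap (x⁻¹ a) (x⁻¹ b) ∈ R x w := by
      refine ⟨⟨_, _, hne, rfl⟩, ?_, ?_⟩
      · rw [Equiv.swap_mul_eq_mul_swap] at hx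
        exact lt_of_le_of_ne (not_lt.mp hx) (invLen_mul_swap_ne x hne).symm
      · rw [← Equiv.swap_mul_eq_mul_swap]
        exact hle.swap_mul hab hdesc
    refine hmsp.ncard_reflectionsBelow_ne hmem ?_
    rw [← Equiv.swap_mul_eq_mul_swap]
    congr 1
    ext t
    refine and_congr_right fun _ => ⟨fun h => ?_, fun h => ?_⟩
    · simpa [← mul_assoc] using h.swap_mul hab hdesc
    · rw [mul_assoc]
      exact h.swap_mul hab hdesc
  · intro hw
    have hdesc : w b' < w a' := (invLen_mul_swap_lt_iff w hlt').mp hw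
    by_contra hx
    have hmem : Equiv.swap a' b' ∈ R x w :=
      ⟨⟨_, _, hlt'.ne, rfl⟩,
        lt_of_le_of_ne (not_lt.mp hx) (invLen_mul_swap_ne x hlt'.ne).symm,
        hle.mul_swap hab' hdesc⟩
    refine hmsp.ncard_reflectionsBelow_ne hmem ?_
    set s := Equiv.swap a' b' with hs
    have hss : s * s = 1 := Equiv.swap_mul_self a' b'
    have hconj : ∀ t ∈ transpositions n, s * t * s ∈ transpositions n := by
      rintro t ⟨c, d, hcd, rfl⟩
      refine ⟨s c, s d, s.injective.ne hcd, ?_⟩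
      rw [Equiv.mul_swap_eq_swap_mul s c d, mul_assoc, hss, mul_one]
    have hcancel : ∀ t, s * (s * t * s) * s = t := fun t => by
      rw [mul_assoc s t s, ← mul_assoc s s, hss, one_mul, mul_assoc, hss, mul_one]
    refine Set.ncard_congr (fun t _ => s * t * s) ?_ ?_ ?_
    · rintro t ⟨ht, h⟩
      refine ⟨hconj t ht, ?_⟩
      simpa only [mul_assoc] using h.mul_swap hab' hdesc
    · intro t u _ _ htu
      rw [← hcancel t, ← hcancel u, htu]
    · rintro t ⟨ht, h⟩
      refine ⟨s * t * s, ⟨hconj t ht, ?_⟩, hcancel t⟩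
      have heq : x * s * (s * t * s) = x * t * s := by
        rw [mul_assoc s t s, mul_assoc x s, ← mul_assoc s s, hss, one_mul, mul_assoc]
      rw [heq]
      exact h.mul_swap hab' hdesc

end BSW
end

section
/- Let x, w ∈ S_n with x ≤ w, and let k = #Δ(x,w), with x̃, w̃ ∈ S_k the flattenings of x and w along Δ(x,w). Then: (1) l(w) − l(x) = l(w̃) − l(x̃); (2) #R(x̃,w̃) = #R(x,w); and (3) x is a maximal singular point (MSP) for w (in S_n) if and only if x̃ is a maximal singular point for w̃ (in S_k). -/
open scoped Classical

namespace BSW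

/-- The contribution of the point `(i, v)` to the rank function at `(p, q)`. -/
def rankTerm (i v : ℕ) (p q : ℤ) : ℤ :=
  if (i : ℤ) + 1 ≤ p ∧ q ≤ (v : ℤ) + 1 then 1 else 0

theorem rank_eq_sum {n : ℕ} (w : Equiv.Perm (Fin n)) (p q : ℤ) :
    (rank w p q : ℤ) = ∑ i : Fin n, rankTerm i (w i) p q := by
  simp only [rank, rankTerm, Finset.natCast_card_filter]

theorem dxw_eq_sum {n : ℕ} (x w : Equiv.Perm (Fin n)) (p q : ℤ) :
    dxw x w p q = ∑ i : Fin n, (rankTerm i (w i) p q - rankTerm i (x i) p q) := by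
  rw [dxw, rank_eq_sum, rank_eq_sum, Finset.sum_sub_distrib]

theorem rank_mul_swap {n : ℕ} (x : Equiv.Perm (Fin n)) {a b : Fin n} (hab : a < b)
    (hx : x a < x b) (p q : ℤ) :
    (rank (x * Equiv.swap a b) p q : ℤ) = rank x p q +
      if (a : ℤ) + 1 ≤ p ∧ p ≤ (b : ℤ) ∧ ((x a : ℕ) : ℤ) + 2 ≤ q ∧ q ≤ ((x b : ℕ) : ℤ) + 1
      then 1 else 0 := by
  rw [← sub_eq_iff_eq_add', rank_eq_sum, rank_eq_sum, ← Finset.sum_sub_distrib,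
    Finset.sum_eq_add a b hab.ne]
  · simp only [Equiv.Perm.mul_apply, Equiv.swap_apply_left, Equiv.swap_apply_right, rankTerm]
    have h₁ : (a : ℕ) < b := hab
    have h₂ : (x a : ℕ) < x b := hx
    split_ifs <;> omega
  · rintro c - ⟨hca, hcb⟩
    rw [Equiv.Perm.mul_apply, Equiv.swap_apply_of_ne_of_ne hca hcb, sub_self]
  · simp
  · simp

theorem dxw_mul_swap {n : ℕ} (x w : Equiv.Perm (Fin n)) {a b : Fin n} (hab : a < b)
    (hx : x a < x b) (p q : ℤ) :
    dxw (x * Equiv.swap a b) w p q = dxw x w p q -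
      if (a : ℤ) + 1 ≤ p ∧ p ≤ (b : ℤ) ∧ ((x a : ℕ) : ℤ) + 2 ≤ q ∧ q ≤ ((x b : ℕ) : ℤ) + 1
      then 1 else 0 := by
  rw [dxw, dxw, rank_mul_swap x hab hx]
  ring

theorem dxw_mul_swap_le {n : ℕ} (x w : Equiv.Perm (Fin n)) {a b : Fin n} (hab : a < b)
    (hx : x a < x b) (p q : ℤ) : dxw (x * Equiv.swap a b) w p q ≤ dxw x w p q := by
  rw [dxw_mul_swap x w hab hx]
  split_ifs <;> omega

theorem bruhatLE_mul_swap_iff {n : ℕ} {x w : Equiv.Perm (Fin n)} (hxw : bruhatLE x w)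
    {a b : Fin n} (hab : a < b) (hx : x a < x b) :
    bruhatLE (x * Equiv.swap a b) w ↔ ∀ p q : ℤ, (a : ℤ) + 1 ≤ p → p ≤ (b : ℤ) →
      ((x a : ℕ) : ℤ) + 2 ≤ q → q ≤ ((x b : ℕ) : ℤ) + 1 → 0 < dxw x w p q := by
  constructor
  · intro h p q h₁ h₂ h₃ h₄
    have := h p q
    rw [dxw_mul_swap x w hab hx, if_pos ⟨h₁, h₂, h₃, h₄⟩] at this
    omega
  · intro h p q
    rw [dxw_mul_swap x w hab hx]
    split_ifs with hpq
    · have := h p q hpq.1 hpq.2.1 hpq.2.2.1 hpq.2.2.2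
      omega
    · simpa using hxw p q

theorem invLen_lt_mul_swap {n : ℕ} (x : Equiv.Perm (Fin n)) {a b : Fin n} (hab : a < b)
    (hx : x a < x b) : invLen x < invLen (x * Equiv.swap a b) := by
  set t := Equiv.swap a b with ht
  have htt : ∀ i, t (t i) = i := Equiv.swap_apply_self a b
  have hta : t a = b := Equiv.swap_apply_left a b
  have htb : t b = a := Equiv.swap_apply_right a b
  have htc : ∀ c, c ≠ a → c ≠ b → t c = c := fun c => Equiv.swap_apply_of_ne_of_ne
  let f : Fin n × Fin n → Fin n × Fin n := fun p => if t p.1 < t p.2 then (t p.1, t p.2) else p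
  unfold invLen
  have hinj : Set.InjOn f (Finset.univ.filter
      (fun p : Fin n × Fin n => p.1 < p.2 ∧ x p.2 < x p.1)) := by
    rintro ⟨i, j⟩ hij ⟨i', j'⟩ hij' h
    simp only [Finset.coe_filter, Finset.mem_univ, true_and, Set.mem_ofPred_eq] at hij hij'
    simp only [f] at h
    split_ifs at h with h₁ h₂ h₂ <;> simp only [Prod.mk.injEq] at h
    · simp [t.injective h.1, t.injective h.2]
    · rw [← h.1, ← h.2, htt, htt] at h₂
      exact absurd hij.1 h₂
    · rw [h.1, h.2, htt, htt] at h₁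
      exact absurd hij'.1 h₁
    · simp [h]
  rw [← Finset.card_image_of_injOn hinj]
  apply Finset.card_lt_card
  rw [Finset.ssubset_iff_of_subset]
  · refine ⟨(a, b), ?_, ?_⟩
    · rw [Finset.mem_filter]
      simp [hab, hx, hta, htb]
    · simp only [Finset.mem_image, Finset.mem_filter, Finset.mem_univ, true_and, Prod.exists,
        not_exists, not_and, and_imp]
      intro i j hij hji h
      simp only [f] at h
      split_ifs at h with h₁ <;> simp only [Prod.mk.injEq] at h
      · rw [← htt i, ← htt j, h.1, h.2, hta, htb] at hij
        exact absurd hij hab.asymm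
      · rw [h.1, h.2] at hji
        exact absurd hji hx.asymm
  · intro p hp
    simp only [Finset.mem_image, Finset.mem_filter, Finset.mem_univ, true_and, Prod.exists] at hp
    obtain ⟨i, j, ⟨hij, hji⟩, rfl⟩ := hp
    rw [Finset.mem_filter]
    simp only [f, Finset.mem_univ, true_and, Equiv.Perm.mul_apply]
    split_ifs with h₁
    · simpa [htt] using ⟨h₁, hji⟩
    · refine ⟨hij, ?_⟩
      change x (t j) < x (t i)
      by_cases hia : i = a
      · subst hia
        by_cases hjb : j = b
        · subst hjb
          exact absurd hji hx.asymm
        · rw [htc j hij.ne' hjb, hta]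
          exact hji.trans hx
      · by_cases hjb : j = b
        · subst hjb
          rw [htc i hia hij.ne, htb]
          exact hx.trans hji
        · exfalso
          by_cases hib : i = b
          · subst hib
            rw [htb, htc j (hab.trans hij).ne' hjb] at h₁
            exact h₁ (hab.trans hij)
          · rw [htc i hia hib] at h₁
            by_cases hja : j = a
            · subst hja
              rw [hta] at h₁
              exact h₁ (hij.trans hab)
            · rw [htc j hja hjb] at h₁
              exact h₁ hij

theorem invLen_lt_mul_swap_iff {n : ℕ} (x : Equiv.Perm (Fin n)) {a b : Fin n} (hab : a < b) :
    invLen x < invLen (x * Equiv.swap a b) ↔ x a < x b := by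
  refine ⟨fun h => ?_, invLen_lt_mul_swap x hab⟩
  by_contra hx
  have hx' : x b < x a := lt_of_le_of_ne (not_lt.1 hx) fun h => hab.ne' (x.injective h)
  have := invLen_lt_mul_swap (x * Equiv.swap a b) hab (by simpa using hx')
  rw [mul_assoc, Equiv.swap_mul_self, mul_one] at this
  exact absurd h this.asymm

theorem swap_mem_R_iff {n : ℕ} {x w : Equiv.Perm (Fin n)} {a b : Fin n} (hab : a < b) :
    Equiv.swap a b ∈ R x w ↔ x a < x b ∧ bruhatLE (x * Equiv.swap a b) w := by
  rw [R, Set.mem_ofPred_eq, invLen_lt_mul_swap_iff x hab]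
  exact ⟨fun h => h.2, fun h => ⟨⟨a, b, hab.ne, rfl⟩, h⟩⟩

theorem exists_lt_of_mem_R {n : ℕ} {x w t : Equiv.Perm (Fin n)} (ht : t ∈ R x w) :
    ∃ a b : Fin n, a < b ∧ t = Equiv.swap a b ∧ x a < x b := by
  obtain ⟨a, b, hab, rfl⟩ := ht.1
  rcases hab.lt_or_gt with h | h
  · exact ⟨a, b, h, rfl, ((swap_mem_R_iff h).1 ht).1⟩
  · rw [Equiv.swap_comm] at ht ⊢
    exact ⟨b, a, h, rfl, ((swap_mem_R_iff h).1 ht).1⟩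

theorem sum_apply_eq_sum_apply {n : ℕ} (x w : Equiv.Perm (Fin n)) (g : Fin n → ℤ) :
    ∑ i, g (w i) = ∑ i, g (x i) := by
  rw [Equiv.sum_comp w g, Equiv.sum_comp x g]

theorem dxw_eq_zero_of_nonpos {n : ℕ} (x w : Equiv.Perm (Fin n)) {p : ℤ} (hp : p ≤ 0) (q : ℤ) :
    dxw x w p q = 0 := by
  rw [dxw_eq_sum]
  refine Finset.sum_eq_zero fun i _ => ?_
  simp only [rankTerm]
  split_ifs <;> omega

theorem dxw_eq_zero_of_le_one {n : ℕ} (x w : Equiv.Perm (Fin n)) (p : ℤ) {q : ℤ} (hq : q ≤ 1) :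
    dxw x w p q = 0 := by
  rw [dxw_eq_sum]
  refine Finset.sum_eq_zero fun i _ => ?_
  simp only [rankTerm]
  split_ifs <;> omega

theorem dxw_eq_zero_of_lt {n : ℕ} (x w : Equiv.Perm (Fin n)) (p : ℤ) {q : ℤ} (hq : (n : ℤ) < q) :
    dxw x w p q = 0 := by
  rw [dxw_eq_sum]
  refine Finset.sum_eq_zero fun i _ => ?_
  simp only [rankTerm]
  have := (x i).isLt
  have := (w i).isLt
  split_ifs <;> omega

theorem dxw_eq_zero_of_ge {n : ℕ} (x w : Equiv.Perm (Fin n)) {p : ℤ} (hp : (n : ℤ) ≤ p) (q : ℤ) :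
    dxw x w p q = 0 := by
  rw [dxw_eq_sum, Finset.sum_sub_distrib, sub_eq_zero]
  have h : ∀ i v : Fin n, rankTerm i v p q = if q ≤ ((v : ℕ) : ℤ) + 1 then 1 else 0 := by
    intro i v
    have := i.isLt
    simp only [rankTerm]
    split_ifs <;> omega
  simp only [h]
  exact sum_apply_eq_sum_apply x w fun v => if q ≤ ((v : ℕ) : ℤ) + 1 then 1 else 0

/-- A rectangle on which the mixed difference of `d_{x,w}` is negative contains a point of the
graph of `x`. -/
theorem exists_point_of_mixed_diff_neg {n : ℕ} {x w : Equiv.Perm (Fin n)} {p p' q q' : ℤ}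
    (hp : p ≤ p') (hq : q ≤ q')
    (h : dxw x w p' q - dxw x w p q - dxw x w p' q' + dxw x w p q' < 0) :
    ∃ b : Fin n, p ≤ (b : ℤ) ∧ (b : ℤ) + 1 ≤ p' ∧ q ≤ ((x b : ℕ) : ℤ) + 1 ∧
      ((x b : ℕ) : ℤ) + 1 < q' := by
  by_contra! hb
  refine h.not_ge ?_
  simp only [dxw_eq_sum, ← Finset.sum_sub_distrib, ← Finset.sum_add_distrib]
  refine Finset.sum_nonneg fun i _ => ?_
  have := hb i
  simp only [rankTerm]
  split_ifs <;> omega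

theorem exists_right_of_dxw_pos {n : ℕ} {x w : Equiv.Perm (Fin n)} (hxw : bruhatLE x w)
    (i : Fin n) (hi : 0 < dxw x w ((i : ℤ) + 1) (((x i : ℕ) : ℤ) + 2)) :
    ∃ b, Equiv.swap i b ∈ R x w := by
  obtain ⟨q', ⟨hq', hdq'⟩, hminq⟩ := Int.exists_least_of_bdd
    (P := fun q => ((x i : ℕ) : ℤ) + 2 ≤ q ∧ dxw x w ((i : ℤ) + 1) q = 0)
    ⟨_, fun z hz => hz.1⟩
    ⟨(n : ℤ) + 1, by have := (x i).isLt; omega, dxw_eq_zero_of_lt _ _ _ (by omega)⟩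
  have hlt : ((x i : ℕ) : ℤ) + 2 < q' := by
    rcases hq'.lt_or_eq with h | h
    · exact h
    · rw [h] at hi; omega
  obtain ⟨p', ⟨hp', q, hq, hqq', hd⟩, hminp⟩ := Int.exists_least_of_bdd
    (P := fun p => (i : ℤ) + 1 ≤ p ∧ ∃ q, ((x i : ℕ) : ℤ) + 2 ≤ q ∧ q < q' ∧ dxw x w p q = 0)
    ⟨_, fun z hz => hz.1⟩
    ⟨(n : ℤ), by have := i.isLt; omega, _, le_rfl, hlt, dxw_eq_zero_of_ge _ _ le_rfl _⟩
  have hpos : 0 < dxw x w ((i : ℤ) + 1) q := by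
    refine lt_of_le_of_ne (hxw _ _) fun h => ?_
    have := hminq q ⟨hq, h.symm⟩
    omega
  have hnn := hxw p' q'
  obtain ⟨b, hb₁, hb₂, hb₃, hb₄⟩ := exists_point_of_mixed_diff_neg (x := x) (w := w) hp' hqq'.le
    (by omega)
  have hib : i < b := by rw [Fin.lt_def]; omega
  have hx : x i < x b := by rw [Fin.lt_def]; omega
  refine ⟨b, (swap_mem_R_iff hib).2 ⟨hx, (bruhatLE_mul_swap_iff hxw hib hx).2 ?_⟩⟩
  intro r s h₁ h₂ h₃ h₄
  refine lt_of_le_of_ne (hxw _ _) fun h => ?_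
  have := hminp r ⟨h₁, s, h₃, by omega, h.symm⟩
  omega

theorem exists_left_of_dxw_pos {n : ℕ} {x w : Equiv.Perm (Fin n)} (hxw : bruhatLE x w)
    (i : Fin n) (hi : 0 < dxw x w (i : ℤ) (((x i : ℕ) : ℤ) + 1)) :
    ∃ a, Equiv.swap i a ∈ R x w := by
  obtain ⟨q', ⟨hq', hdq'⟩, hmaxq⟩ := Int.exists_greatest_of_bdd
    (P := fun q => q ≤ ((x i : ℕ) : ℤ) + 1 ∧ dxw x w (i : ℤ) q = 0)
    ⟨_, fun z hz => hz.1⟩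
    ⟨1, by omega, dxw_eq_zero_of_le_one _ _ _ (by omega)⟩
  have hlt : q' < ((x i : ℕ) : ℤ) + 1 := by
    rcases hq'.lt_or_eq with h | h
    · exact h
    · rw [← h] at hi; omega
  obtain ⟨p', ⟨hp', q, hq, hqq', hd⟩, hmaxp⟩ := Int.exists_greatest_of_bdd
    (P := fun p => p ≤ (i : ℤ) ∧ ∃ q, q ≤ ((x i : ℕ) : ℤ) + 1 ∧ q' < q ∧ dxw x w p q = 0)
    ⟨_, fun z hz => hz.1⟩
    ⟨0, by omega, _, le_rfl, hlt, dxw_eq_zero_of_nonpos _ _ le_rfl _⟩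
  have hpos : 0 < dxw x w (i : ℤ) q := by
    refine lt_of_le_of_ne (hxw _ _) fun h => ?_
    have := hmaxq q ⟨hq, h.symm⟩
    omega
  have hnn := hxw p' q'
  obtain ⟨a, ha₁, ha₂, ha₃, ha₄⟩ := exists_point_of_mixed_diff_neg (x := x) (w := w) hp' hqq'.le
    (by omega)
  have hai : a < i := by rw [Fin.lt_def]; omega
  have hx : x a < x i := by rw [Fin.lt_def]; omega
  refine ⟨a, ?_⟩
  rw [Equiv.swap_comm]
  refine (swap_mem_R_iff hai).2 ⟨hx, (bruhatLE_mul_swap_iff hxw hai hx).2 ?_⟩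
  intro r s h₁ h₂ h₃ h₄
  refine lt_of_le_of_ne (hxw _ _) fun h => ?_
  have := hmaxp r ⟨h₂, s, h₄, by omega, h.symm⟩
  omega

/-- `x ≤ w`, and for every position `c` outside `D`, the function `d_{x,w}` vanishes on the boxes
north-east and south-west of the point `(c, x c)`. -/
structure Supported {n : ℕ} (D : Finset (Fin n)) (x w : Equiv.Perm (Fin n)) : Prop where
  le : bruhatLE x w
  ne : ∀ c ∉ D, dxw x w ((c : ℤ) + 1) (((x c : ℕ) : ℤ) + 2) = 0
  sw : ∀ c ∉ D, dxw x w (c : ℤ) (((x c : ℕ) : ℤ) + 1) = 0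

theorem supported_DeltaFinset {n : ℕ} {x w : Equiv.Perm (Fin n)} (hxw : bruhatLE x w) :
    Supported (DeltaFinset x w) x w := by
  have hmem : ∀ c, c ∈ DeltaFinset x w ↔ ∃ j, Equiv.swap c j ∈ R x w := fun c => by
    simp [DeltaFinset, Delta]
  refine ⟨hxw, fun c hc => ?_, fun c hc => ?_⟩ <;> rw [hmem] at hc
  · by_contra h
    exact hc (exists_right_of_dxw_pos hxw c (lt_of_le_of_ne (hxw _ _) (Ne.symm h)))
  · by_contra h
    exact hc (exists_left_of_dxw_pos hxw c (lt_of_le_of_ne (hxw _ _) (Ne.symm h)))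

theorem dxw_column_step {n : ℕ} (x w : Equiv.Perm (Fin n)) (c : Fin n) (q : ℤ) :
    dxw x w ((c : ℤ) + 1) q - dxw x w (c : ℤ) q =
      (if q ≤ ((w c : ℕ) : ℤ) + 1 then 1 else 0) - if q ≤ ((x c : ℕ) : ℤ) + 1 then 1 else 0 := by
  rw [dxw_eq_sum, dxw_eq_sum, ← Finset.sum_sub_distrib, Finset.sum_eq_single c]
  · simp only [rankTerm]
    split_ifs <;> omega
  · intro b _ hb
    have hb' : (b : ℕ) ≠ c := fun h => hb (Fin.ext h)
    simp only [rankTerm]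
    split_ifs <;> omega
  · simp

namespace Supported

variable {n : ℕ} {D : Finset (Fin n)} {x w : Equiv.Perm (Fin n)}

theorem apply_eq (h : Supported D x w) {c : Fin n} (hc : c ∉ D) : x c = w c := by
  have h₁ := h.ne c hc
  have h₂ := h.sw c hc
  have h₃ := h.le (c : ℤ) (((x c : ℕ) : ℤ) + 2)
  have h₄ := h.le ((c : ℤ) + 1) (((x c : ℕ) : ℤ) + 1)
  have h₅ := dxw_column_step x w c (((x c : ℕ) : ℤ) + 2)
  have h₆ := dxw_column_step x w c (((x c : ℕ) : ℤ) + 1)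
  apply Fin.ext
  split_ifs at h₅ h₆ <;> omega

theorem nw (h : Supported D x w) {c : Fin n} (hc : c ∉ D) :
    dxw x w (c : ℤ) (((x c : ℕ) : ℤ) + 2) = 0 := by
  have h₅ := dxw_column_step x w c (((x c : ℕ) : ℤ) + 2)
  rw [h.ne c hc, ← h.apply_eq hc] at h₅
  omega

theorem se (h : Supported D x w) {c : Fin n} (hc : c ∉ D) :
    dxw x w ((c : ℤ) + 1) (((x c : ℕ) : ℤ) + 1) = 0 := by
  have h₅ := dxw_column_step x w c (((x c : ℕ) : ℤ) + 1)
  rw [h.sw c hc, ← h.apply_eq hc] at h₅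
  omega

theorem mem_of_swap_mem_R (h : Supported D x w) {a b : Fin n} (hab : a < b)
    (ht : Equiv.swap a b ∈ R x w) : a ∈ D ∧ b ∈ D := by
  rw [swap_mem_R_iff hab] at ht
  obtain ⟨hx, hle⟩ := ht
  rw [bruhatLE_mul_swap_iff h.le hab hx] at hle
  have h₁ : (a : ℕ) < b := hab
  have h₂ : (x a : ℕ) < x b := hx
  constructor <;> by_contra hc
  · have := hle ((a : ℤ) + 1) (((x a : ℕ) : ℤ) + 2) (by omega) (by omega) (by omega) (by omega)
    rw [h.ne a hc] at this
    omega
  · have := hle (b : ℤ) (((x b : ℕ) : ℤ) + 1) (by omega) (by omega) (by omega) (by omega)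
    rw [h.sw b hc] at this
    omega

theorem mul_of_mem_R (h : Supported D x w) {t : Equiv.Perm (Fin n)} (ht : t ∈ R x w) :
    Supported D (x * t) w := by
  obtain ⟨a, b, hab, rfl, hx⟩ := exists_lt_of_mem_R ht
  obtain ⟨ha, hb⟩ := h.mem_of_swap_mem_R hab ht
  have hle := ht.2.2
  have hc' : ∀ c ∉ D, (x * Equiv.swap a b) c = x c := fun c hc => by
    rw [Equiv.Perm.mul_apply, Equiv.swap_apply_of_ne_of_ne]
    · rintro rfl; exact hc ha
    · rintro rfl; exact hc hb
  refine ⟨hle, fun c hc => ?_, fun c hc => ?_⟩ <;> rw [hc' c hc]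
  · exact le_antisymm ((dxw_mul_swap_le x w hab hx _ _).trans (h.ne c hc).le) (hle _ _)
  · exact le_antisymm ((dxw_mul_swap_le x w hab hx _ _).trans (h.sw c hc).le) (hle _ _)

end Supported

/-- The indicator of an inversion at the pair of positions `(i, j)`. -/
def invTerm {n : ℕ} (w : Equiv.Perm (Fin n)) (i j : Fin n) : ℤ :=
  if i < j ∧ w j < w i then 1 else 0

theorem invLen_eq_sum {n : ℕ} (w : Equiv.Perm (Fin n)) :
    (invLen w : ℤ) = ∑ i, ∑ j, invTerm w i j := by
  simp only [invLen, invTerm, Finset.natCast_card_filter, Fintype.sum_prod_type]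

theorem sum_eq_sum_of_row_col_zero {ι : Type*} [Fintype ι] (D : Finset ι) (h : ι → ι → ℤ)
    (hrow : ∀ c ∉ D, ∑ j, h c j = 0) (hcol : ∀ c ∉ D, ∑ i, h i c = 0)
    (hoff : ∀ c ∉ D, ∀ c' ∉ D, h c c' = 0) :
    ∑ i, ∑ j, h i j = ∑ i ∈ D, ∑ j ∈ D, h i j := by
  rw [← Finset.sum_add_sum_compl D, Finset.sum_eq_zero (s := Dᶜ)
    fun c hc => hrow c (Finset.mem_compl.1 hc), add_zero]
  simp only [← Finset.sum_add_sum_compl D (fun j => h _ j), Finset.sum_add_distrib]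
  rw [add_eq_left, Finset.sum_comm]
  refine Finset.sum_eq_zero fun c hc => ?_
  have hc := Finset.mem_compl.1 hc
  have h₁ := hcol c hc
  rwa [← Finset.sum_add_sum_compl D, Finset.sum_eq_zero (s := Dᶜ)
    fun c' hc' => hoff c' (Finset.mem_compl.1 hc') c hc, add_zero] at h₁

theorem Supported.invLen_sub {n : ℕ} {D : Finset (Fin n)} {x w : Equiv.Perm (Fin n)}
    (h : Supported D x w) :
    (invLen w : ℤ) - invLen x = ∑ i ∈ D, ∑ j ∈ D, (invTerm w i j - invTerm x i j) := by
  rw [invLen_eq_sum, invLen_eq_sum, ← Finset.sum_sub_distrib]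
  simp only [← Finset.sum_sub_distrib]
  apply sum_eq_sum_of_row_col_zero
  · intro c hc
    have hw := h.apply_eq hc
    have hval := sum_apply_eq_sum_apply x w fun v => if ((x c : ℕ) : ℤ) ≤ (v : ℕ) then (1 : ℤ) else 0
    rw [← sub_eq_zero, ← Finset.sum_sub_distrib] at hval
    have hse := h.se hc
    rw [dxw_eq_sum] at hse
    rw [← sub_eq_zero.2 (hse.trans hval.symm), ← Finset.sum_sub_distrib]
    refine Finset.sum_congr rfl fun j _ => ?_
    simp only [invTerm, rankTerm, ← hw, Fin.lt_def]
    split_ifs <;> omega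
  · intro c hc
    have hw := h.apply_eq hc
    rw [← h.nw hc, dxw_eq_sum]
    refine Finset.sum_congr rfl fun j _ => ?_
    simp only [invTerm, rankTerm, ← hw, Fin.lt_def]
    split_ifs <;> omega
  · intro c hc c' hc'
    simp only [invTerm, h.apply_eq hc, h.apply_eq hc', sub_self]

/-- `σ` is the pattern of `x` along the positions `e 0 < e 1 < …`. -/
def IsPattern {n k : ℕ} (e : Fin k ↪o Fin n) (x : Equiv.Perm (Fin n)) (σ : Equiv.Perm (Fin k)) :
    Prop :=
  ∀ a b, σ a < σ b ↔ x (e a) < x (e b)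

section Pattern

variable {n k : ℕ} {e : Fin k ↪o Fin n} {x w : Equiv.Perm (Fin n)} {xt wt : Equiv.Perm (Fin k)}

theorem IsPattern.mul_swap (h : IsPattern e x xt) (a b : Fin k) :
    IsPattern e (x * Equiv.swap (e a) (e b)) (xt * Equiv.swap a b) := by
  intro c d
  simp only [Equiv.Perm.mul_apply, e.injective.swap_apply]
  exact h _ _

theorem IsPattern.strictMono (h : IsPattern e x xt) : StrictMono fun v => x (e (xt⁻¹ v)) := by
  intro u v huv
  rw [← h]
  simpa using huv

theorem IsPattern.exists_values (hx : IsPattern e x xt) (hw : IsPattern e w wt)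
    (hoff : ∀ c ∉ Set.range e, x c = w c) :
    ∃ f : Fin k → Fin n, StrictMono f ∧ (∀ a, x (e a) = f (xt a)) ∧ ∀ a, w (e a) = f (wt a) := by
  have hrange : ∀ {y : Equiv.Perm (Fin n)} {yt : Equiv.Perm (Fin k)},
      Set.range (fun v => y (e (yt⁻¹ v))) = (y '' (Set.range e)ᶜ)ᶜ := by
    intro y yt
    rw [Set.image_compl_eq y.bijective, compl_compl]
    ext v
    constructor
    · rintro ⟨a, rfl⟩
      exact ⟨_, ⟨_, rfl⟩, rfl⟩
    · rintro ⟨_, ⟨a, rfl⟩, rfl⟩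
      exact ⟨yt a, by simp⟩
  have himage : x '' (Set.range e)ᶜ = w '' (Set.range e)ᶜ := Set.image_congr hoff
  have heq : (fun v => x (e (xt⁻¹ v))) = fun v => w (e (wt⁻¹ v)) := by
    rw [← hx.strictMono.range_inj hw.strictMono, hrange, hrange, himage]
  refine ⟨_, hx.strictMono, fun a => by simp, fun a => ?_⟩
  simpa using (congrFun heq (wt a)).symm

theorem exists_cut {m : ℕ} (S : Fin m → Prop) (hS : ∀ a b, a ≤ b → S b → S a) :
    ∃ P : ℤ, ∀ a : Fin m, (a : ℤ) + 1 ≤ P ↔ S a := by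
  by_cases hall : ∀ a, S a
  · exact ⟨m, fun a => ⟨fun _ => hall a, fun _ => by have := a.isLt; omega⟩⟩
  · push Not at hall
    obtain ⟨b, hb, hmin⟩ := WellFounded.has_min (wellFounded_lt (α := Fin m)) {a | ¬ S a} hall
    refine ⟨b, fun a => ⟨fun h => ?_, fun h => ?_⟩⟩
    · by_contra ha
      have := hmin a ha
      rw [Fin.lt_def] at this
      omega
    · by_contra hba
      exact hb (hS b a (by rw [Fin.le_def]; omega) h)

theorem exists_cut_comap {f : Fin k → Fin n} (hf : StrictMono f) (p : ℤ) :
    ∃ P : ℤ, ∀ a : Fin k, (a : ℤ) + 1 ≤ P ↔ ((f a : ℕ) : ℤ) + 1 ≤ p := by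
  refine exists_cut (fun a => ((f a : ℕ) : ℤ) + 1 ≤ p) fun a b hab hb => ?_
  have : (f a : ℕ) ≤ f b := hf.monotone hab
  omega

theorem exists_cut_map {f : Fin k → Fin n} (hf : StrictMono f) (P : ℤ) :
    ∃ p : ℤ, ∀ a : Fin k, (a : ℤ) + 1 ≤ P ↔ ((f a : ℕ) : ℤ) + 1 ≤ p := by
  obtain ⟨p, hp⟩ := exists_cut (fun i : Fin n => ∃ a : Fin k, i ≤ f a ∧ (a : ℤ) + 1 ≤ P)
    fun i j hij ⟨a, ha, haP⟩ => ⟨a, hij.trans ha, haP⟩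
  refine ⟨p, fun a => ?_⟩
  rw [hp]
  refine ⟨fun h => ⟨a, le_rfl, h⟩, fun ⟨b, hb, hbP⟩ => ?_⟩
  have : (a : ℕ) ≤ b := hf.le_iff_le.1 hb
  omega

theorem sum_eq_sum_range (g : Fin n → ℤ) (hg : ∀ c ∉ Set.range e, g c = 0) :
    ∑ i, g i = ∑ a, g (e a) :=
  (Fintype.sum_of_injective e e.injective _ _ hg fun _ => rfl).symm

theorem IsPattern.bruhatLE_iff (hx : IsPattern e x xt) (hw : IsPattern e w wt)
    (hoff : ∀ c ∉ Set.range e, x c = w c) : bruhatLE x w ↔ bruhatLE xt wt := by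
  obtain ⟨f, hf, hxf, hwf⟩ := hx.exists_values hw hoff
  have key : ∀ p q P Q : ℤ, (∀ a : Fin k, (a : ℤ) + 1 ≤ P ↔ ((e a : ℕ) : ℤ) + 1 ≤ p) →
      (∀ a : Fin k, (a : ℤ) + 1 ≤ Q - 1 ↔ ((f a : ℕ) : ℤ) + 1 ≤ q - 1) →
      dxw x w p q = dxw xt wt P Q := by
    intro p q P Q hP hQ
    have hterm : ∀ a v : Fin k, rankTerm (e a) (f v) p q = rankTerm a v P Q := by
      intro a v
      have h₁ := hP a
      have h₂ := hQ v
      simp only [rankTerm]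
      split_ifs <;> omega
    rw [dxw_eq_sum, dxw_eq_sum, sum_eq_sum_range (e := e)]
    · simp only [hxf, hwf, hterm]
    · intro c hc
      rw [hoff c hc, sub_self]
  constructor
  · intro h P Q
    obtain ⟨p, hp⟩ := exists_cut_map e.strictMono P
    obtain ⟨q, hq⟩ := exists_cut_map hf (Q - 1)
    rw [← key p (q + 1) P Q hp (by simpa using hq)]
    exact h _ _
  · intro h p q
    obtain ⟨P, hP⟩ := exists_cut_comap e.strictMono p
    obtain ⟨Q, hQ⟩ := exists_cut_comap hf (q - 1)
    rw [key p q P (Q + 1) hP (by simpa using hQ)]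
    exact h _ _

theorem Supported.apply_eq_of_notMem_range (h : Supported (Finset.univ.map e.toEmbedding) x w) :
    ∀ c ∉ Set.range e, x c = w c := fun c hc => h.apply_eq (by simpa using hc)

theorem Supported.invLen_sub_eq (h : Supported (Finset.univ.map e.toEmbedding) x w)
    (hx : IsPattern e x xt) (hw : IsPattern e w wt) :
    (invLen w : ℤ) - invLen x = invLen wt - invLen xt := by
  have hterm : ∀ {y : Equiv.Perm (Fin n)} {yt : Equiv.Perm (Fin k)}, IsPattern e y yt →
      ∀ a b, invTerm y (e a) (e b) = invTerm yt a b := by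
    intro y yt hy a b
    simp only [invTerm, hy b a, e.lt_iff_lt]
  rw [h.invLen_sub, invLen_eq_sum, invLen_eq_sum, ← Finset.sum_sub_distrib]
  simp [Finset.sum_map, hterm hx, hterm hw]

theorem Supported.swap_mem_R_iff (h : Supported (Finset.univ.map e.toEmbedding) x w)
    (hx : IsPattern e x xt) (hw : IsPattern e w wt) {a b : Fin k} (hab : a < b) :
    Equiv.swap (e a) (e b) ∈ R x w ↔ Equiv.swap a b ∈ R xt wt := by
  rw [BSW.swap_mem_R_iff hab, BSW.swap_mem_R_iff (e.lt_iff_lt.2 hab), hx a b,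
    (hx.mul_swap a b).bruhatLE_iff hw]
  intro c hc
  rw [Equiv.Perm.mul_apply, Equiv.swap_apply_of_ne_of_ne, h.apply_eq_of_notMem_range c hc]
  · rintro rfl; exact hc ⟨_, rfl⟩
  · rintro rfl; exact hc ⟨_, rfl⟩

theorem viaEmbedding_swap (a b : Fin k) :
    (Equiv.swap a b).viaEmbedding e.toEmbedding = Equiv.swap (e a) (e b) := by
  ext1 i
  by_cases hi : i ∈ Set.range e
  · obtain ⟨c, rfl⟩ := hi
    rw [e.injective.swap_apply]
    exact Equiv.Perm.viaEmbedding_apply _ e.toEmbedding c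
  · rw [Equiv.Perm.viaEmbedding_apply_of_notMem _ _ _ (by simpa using hi),
      Equiv.swap_apply_of_ne_of_ne]
    · rintro rfl; exact hi ⟨_, rfl⟩
    · rintro rfl; exact hi ⟨_, rfl⟩

theorem Supported.R_eq_image (h : Supported (Finset.univ.map e.toEmbedding) x w)
    (hx : IsPattern e x xt) (hw : IsPattern e w wt) :
    R x w = (fun s : Equiv.Perm (Fin k) => s.viaEmbedding e.toEmbedding) '' R xt wt := by
  ext t
  constructor
  · intro ht
    obtain ⟨i, j, hij, rfl, -⟩ := exists_lt_of_mem_R ht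
    obtain ⟨hi, hj⟩ := h.mem_of_swap_mem_R hij ht
    simp only [Finset.mem_map, Finset.mem_univ, true_and] at hi hj
    obtain ⟨a, rfl⟩ := hi
    obtain ⟨b, rfl⟩ := hj
    exact ⟨Equiv.swap a b, (h.swap_mem_R_iff hx hw (e.lt_iff_lt.1 hij)).1 ht,
      viaEmbedding_swap a b⟩
  · rintro ⟨s, hs, rfl⟩
    obtain ⟨a, b, hab, rfl, -⟩ := exists_lt_of_mem_R hs
    simp only [viaEmbedding_swap]
    exact (h.swap_mem_R_iff hx hw hab).2 hs

theorem Supported.ncard_R_eq (h : Supported (Finset.univ.map e.toEmbedding) x w)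
    (hx : IsPattern e x xt) (hw : IsPattern e w wt) : (R x w).ncard = (R xt wt).ncard := by
  rw [h.R_eq_image hx hw]
  exact Set.ncard_image_of_injective _ (Equiv.Perm.viaEmbeddingHom_injective e.toEmbedding)

theorem Supported.MSP_iff (h : Supported (Finset.univ.map e.toEmbedding) x w)
    (hx : IsPattern e x xt) (hw : IsPattern e w wt) : MSP x w ↔ MSP xt wt := by
  rw [MSP, MSP, hx.bruhatLE_iff hw h.apply_eq_of_notMem_range, h.invLen_sub_eq hx hw,
    h.ncard_R_eq hx hw, h.R_eq_image hx hw, Set.forall_mem_image]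
  refine and_congr_right fun _ => and_congr_right fun _ => forall₂_congr fun s hs => ?_
  obtain ⟨a, b, hab, rfl, -⟩ := exists_lt_of_mem_R hs
  simp only [viaEmbedding_swap]
  have h' := h.mul_of_mem_R ((h.swap_mem_R_iff hx hw hab).2 hs)
  rw [h'.ncard_R_eq (hx.mul_swap a b) hw, h'.invLen_sub_eq (hx.mul_swap a b) hw]

end Pattern

/-- For `x ≤ w` with flattenings `x̃, w̃ ∈ S_K` along `Δ(x,w)` (`K = #Δ(x,w)`):
(1) `l(w) − l(x) = l(w̃) − l(x̃)`; (2) `#R(x̃,w̃) = #R(x,w)`; and (3) `x` is an MSP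
for `w` iff `x̃` is an MSP for `w̃`. -/
theorem flattening_preserves_msp {n K : ℕ} (x w : Equiv.Perm (Fin n))
    (hxw : bruhatLE x w) (hK : (DeltaFinset x w).card = K)
    (xt wt : Equiv.Perm (Fin K))
    (hxt : IsFlatteningOn x (DeltaFinset x w) hK xt)
    (hwt : IsFlatteningOn w (DeltaFinset x w) hK wt) :
    ((invLen w : ℤ) - (invLen x : ℤ) = (invLen wt : ℤ) - (invLen xt : ℤ)) ∧
      (R xt wt).ncard = (R x w).ncard ∧
      (MSP x w ↔ MSP xt wt) := by
  set e := (DeltaFinset x w).orderEmbOfFin hK with he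
  have hmap : Finset.univ.map e.toEmbedding = DeltaFinset x w := Finset.map_orderEmbOfFin_univ _ hK
  have h : Supported (Finset.univ.map e.toEmbedding) x w := hmap ▸ supported_DeltaFinset hxw
  have hx : IsPattern e x xt := hxt
  have hw : IsPattern e w wt := hwt
  exact ⟨h.invLen_sub_eq hx hw, (h.ncard_R_eq hx hw).symm, h.MSP_iff hx hw⟩

end BSW
end
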